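/- Let f : ℝ × ℝ → ℝ be C^∞ and let u be a C^∞ solution of u'(t) = f(t, u(t)) on [a,b]. Fix t ∈ [a,b), write f, f_t, f_u, f_tt, f_tu, f_uu for f and its partial derivatives evaluated at (t, u(t)) and write v = u(t). Take the three-stage MQ-RBF Runge–Kutta method with a₂₁ = c₂ = 1, a₃₁ = 1/4, a₃₂ = 1/4, c₃ = 1/2, b₁ = 1/6, b₂ = 1/6, b₃ = 2/3, and shape parameters ε₂² = (f·f_t·f_uu + f·f_u³ − f·f_u·f_tu + f_t·f_u² + f_t·f_tu − f_tt·f_u)/(v·f·f_uu + 2v·f_u² + v·f_tu + f·f_u) and ε₃² = −ε₂², assuming the denominator v·f·f_uu + 2v·f_u² + v·f_tu + f·f_u is nonzero. Then the local truncation error τ(t,h) satisfies τ(t,h) = O(h⁴) as h → 0⁺; that is, there exist C > 0 and h₀ > 0 such that |τ(t,h)| ≤ C h⁴ for all 0 < h ≤ h₀ (so the method is fourth-order accurate). -/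

import Mathlib

/-- Directional (partial) derivative of `f : ℝ × ℝ → ℝ` in the direction `d`;
`pd f (1,0) = f_t`, `pd f (0,1) = f_u`, and iterates give higher partials. -/
noncomputable def pd (f : ℝ × ℝ → ℝ) (d : ℝ × ℝ) : ℝ × ℝ → ℝ :=
  fun p => fderiv ℝ f p d

open Asymptotics Filter Topology

/-- If the derivative of `G` on a convex set is `O(‖w‖ ^ n)` at `0`, then `G w - G 0` is
`O(‖w‖ ^ (n + 1))`. -/
lemma isBigO_norm_pow_succ_of_hasFDerivWithinAt {E : Type*} [NormedAddCommGroup E]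
    [NormedSpace ℝ E] {G : E → ℝ} {G' : E → E →L[ℝ] ℝ} {s : Set E} {n : ℕ}
    (hs : Convex ℝ s) (h0 : (0 : E) ∈ s) (hG : ∀ w ∈ s, HasFDerivWithinAt G (G' w) s w)
    (hG' : G' =O[𝓝[s] 0] fun w => ‖w‖ ^ n) :
    (fun w => G w - G 0) =O[𝓝[s] 0] fun w => ‖w‖ ^ (n + 1) := by
  obtain ⟨C, hC, hb⟩ := hG'.exists_pos
  have hb := hb.bound
  rw [Metric.nhdsWithin_basis_ball.eventually_iff] at hb
  obtain ⟨δ, hδ, hb⟩ := hb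
  refine IsBigO.of_bound C ?_
  rw [Metric.nhdsWithin_basis_ball.eventually_iff]
  refine ⟨δ, hδ, fun w hw => ?_⟩
  have hwδ : ‖w‖ < δ := by simpa using hw.1
  have key := (hs.inter (convex_closedBall (0 : E) ‖w‖)).norm_image_sub_le_of_norm_hasFDerivWithin_le
    (f := G) (f' := G') (C := C * ‖w‖ ^ n) (x := 0) (y := w)
    (fun x hx => (hG x hx.1).mono Set.inter_subset_left)
    (fun x hx => by
      have hx2 : ‖x‖ ≤ ‖w‖ := by simpa using hx.2
      have h1 := hb (x := x) ⟨by simpa using hx2.trans_lt hwδ, hx.1⟩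
      rw [norm_pow, norm_norm] at h1
      exact h1.trans (by gcongr))
    ⟨h0, by simp⟩ ⟨hw.2, by simp⟩
  rw [sub_zero] at key
  rw [norm_pow, norm_norm, pow_succ, ← mul_assoc]
  exact key

lemma ContDiff.pd {g : ℝ × ℝ → ℝ} (hg : ContDiff ℝ (⊤ : ℕ∞) g) (d : ℝ × ℝ) :
    ContDiff ℝ (⊤ : ℕ∞) (pd g d) :=
  (hg.fderiv_right (m := (⊤ : ℕ∞)) (by simp)).clm_apply contDiff_const

lemma pd_comm {g : ℝ × ℝ → ℝ} (hg : ContDiff ℝ (⊤ : ℕ∞) g) (d e : ℝ × ℝ) :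
    pd (pd g d) e = pd (pd g e) d := by
  have hd : Differentiable ℝ (fderiv ℝ g) :=
    (hg.fderiv_right (m := (⊤ : ℕ∞)) (by simp)).differentiable (by simp)
  have key : ∀ d e p, pd (pd g d) e p = fderiv ℝ (fderiv ℝ g) p e d := fun d e p => by
    have := (hd p).hasFDerivAt.clm_apply (hasFDerivAt_const d p)
    change fderiv ℝ (fun p => fderiv ℝ g p d) p e = _
    rw [this.fderiv]
    simp
  ext p
  rw [key, key]
  exact (hg.contDiffAt.isSymmSndFDerivAt (by
    rw [minSmoothness_of_isRCLikeNormedField]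
    exact WithTop.coe_le_coe.2 le_top)) e d

lemma pd_comp_add_left (f : ℝ × ℝ → ℝ) (p d : ℝ × ℝ) :
    pd (fun w => f (p + w)) d = fun w => pd f d (p + w) := by
  ext w
  simp only [pd, fderiv_comp_add_left]

/-- If the partial derivatives of `g` and `P` agree up to `O(‖w‖ ^ n)` at `0`, then so do the
increments of `g` and `P` up to `O(‖w‖ ^ (n + 1))`. -/
lemma isBigO_sub_of_partials {g P Px Py : ℝ × ℝ → ℝ} {n : ℕ} (hg : Differentiable ℝ g)
    (hP : ∀ w, HasFDerivAt P
      (Px w • ContinuousLinearMap.fst ℝ ℝ ℝ + Py w • ContinuousLinearMap.snd ℝ ℝ ℝ) w)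
    (h0 : P 0 = g 0)
    (hx : (fun w => pd g (1, 0) w - Px w) =O[𝓝 0] fun w => ‖w‖ ^ n)
    (hy : (fun w => pd g (0, 1) w - Py w) =O[𝓝 0] fun w => ‖w‖ ^ n) :
    (fun w => g w - P w) =O[𝓝 0] fun w => ‖w‖ ^ (n + 1) := by
  have hG : ∀ w, HasFDerivAt (fun w => g w - P w)
      ((pd g (1, 0) w - Px w) • ContinuousLinearMap.fst ℝ ℝ ℝ +
        (pd g (0, 1) w - Py w) • ContinuousLinearMap.snd ℝ ℝ ℝ) w := fun w => by
    refine ((hg w).hasFDerivAt.sub (hP w)).congr_fderiv ?_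
    ext <;> simp [pd]
  have := isBigO_norm_pow_succ_of_hasFDerivWithinAt (n := n) convex_univ (Set.mem_univ 0)
    (fun w _ => (hG w).hasFDerivWithinAt) (by
      rw [nhdsWithin_univ]
      refine IsBigO.add ?_ ?_
      · simpa using hx.smul (isBigO_const_const (ContinuousLinearMap.fst ℝ ℝ ℝ)
          (one_ne_zero (α := ℝ)) (𝓝 0))
      · simpa using hy.smul (isBigO_const_const (ContinuousLinearMap.snd ℝ ℝ ℝ)
          (one_ne_zero (α := ℝ)) (𝓝 0)))
  simpa [nhdsWithin_univ, h0] using this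

lemma isBigO_taylor_zero {g : ℝ × ℝ → ℝ} (hg : ContDiff ℝ (⊤ : ℕ∞) g) :
    (fun w => g w - g 0) =O[𝓝 0] fun w => ‖w‖ ^ 1 := by
  have := (hg.differentiable (by simp) 0).hasFDerivAt.isBigO_sub
  simpa using this.norm_right

lemma isBigO_taylor_one {g : ℝ × ℝ → ℝ} (hg : ContDiff ℝ (⊤ : ℕ∞) g) :
    (fun w => g w - (g 0 + pd g (1, 0) 0 * w.1 + pd g (0, 1) 0 * w.2))
      =O[𝓝 0] fun w => ‖w‖ ^ 2 := by
  refine isBigO_sub_of_partials (n := 1) (hg.differentiable (by simp))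
    (Px := fun _ => pd g (1, 0) 0) (Py := fun _ => pd g (0, 1) 0) (fun w => ?_) (by simp)
    (isBigO_taylor_zero (hg.pd _)) (isBigO_taylor_zero (hg.pd _))
  have h1 := (hasFDerivAt_fst (𝕜 := ℝ) (p := w)).const_mul (pd g (1, 0) 0)
  have h2 := (hasFDerivAt_snd (𝕜 := ℝ) (p := w)).const_mul (pd g (0, 1) 0)
  exact (h1.const_add (g 0)).add h2

lemma isBigO_taylor_two {g : ℝ × ℝ → ℝ} (hg : ContDiff ℝ (⊤ : ℕ∞) g) :
    (fun w => g w - (g 0 + pd g (1, 0) 0 * w.1 + pd g (0, 1) 0 * w.2 +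
      (1 / 2) * (pd (pd g (1, 0)) (1, 0) 0 * w.1 ^ 2 +
        2 * pd (pd g (1, 0)) (0, 1) 0 * (w.1 * w.2) + pd (pd g (0, 1)) (0, 1) 0 * w.2 ^ 2)))
      =O[𝓝 0] fun w => ‖w‖ ^ 3 := by
  refine isBigO_sub_of_partials (n := 2) (hg.differentiable (by simp)) (fun w => ?_) (by simp)
    (isBigO_taylor_one (hg.pd _)) (isBigO_taylor_one (hg.pd _))
  have h1 := hasFDerivAt_fst (𝕜 := ℝ) (p := w)
  have h2 := hasFDerivAt_snd (𝕜 := ℝ) (p := w)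
  refine HasFDerivAt.congr_fderiv ((((h1.const_mul (pd g (1, 0) 0)).const_add (g 0)).add
    (h2.const_mul (pd g (0, 1) 0))).add
    (((((h1.pow 2).const_mul (pd (pd g (1, 0)) (1, 0) 0)).add
      ((h1.mul h2).const_mul (2 * pd (pd g (1, 0)) (0, 1) 0))).add
      ((h2.pow 2).const_mul (pd (pd g (0, 1)) (0, 1) 0))).const_mul (1 / 2))) ?_
  rw [pd_comm hg (0, 1) (1, 0)]
  ext <;> simp <;> ring

lemma exists_isBigO_taylor_three {g : ℝ × ℝ → ℝ} (hg : ContDiff ℝ (⊤ : ℕ∞) g) :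
    ∃ c₀ c₁ c₂ c₃ : ℝ,
    (fun w => g w - (g 0 + pd g (1, 0) 0 * w.1 + pd g (0, 1) 0 * w.2 +
      (1 / 2) * (pd (pd g (1, 0)) (1, 0) 0 * w.1 ^ 2 +
        2 * pd (pd g (1, 0)) (0, 1) 0 * (w.1 * w.2) + pd (pd g (0, 1)) (0, 1) 0 * w.2 ^ 2) +
      (c₀ * w.1 ^ 3 + c₁ * (w.1 ^ 2 * w.2) + c₂ * (w.1 * w.2 ^ 2) + c₃ * w.2 ^ 3)))
      =O[𝓝 0] fun w => ‖w‖ ^ 4 := by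
  refine ⟨pd (pd (pd g (1, 0)) (1, 0)) (1, 0) 0 / 6, pd (pd (pd g (1, 0)) (1, 0)) (0, 1) 0 / 2,
    pd (pd (pd g (1, 0)) (0, 1)) (0, 1) 0 / 2, pd (pd (pd g (0, 1)) (0, 1)) (0, 1) 0 / 6, ?_⟩
  refine isBigO_sub_of_partials (n := 3) (hg.differentiable (by simp)) (fun w => ?_) (by simp)
    (isBigO_taylor_two (hg.pd _)) (isBigO_taylor_two (hg.pd _))
  have h1 := hasFDerivAt_fst (𝕜 := ℝ) (p := w)
  have h2 := hasFDerivAt_snd (𝕜 := ℝ) (p := w)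
  refine HasFDerivAt.congr_fderiv (((((h1.const_mul (pd g (1, 0) 0)).const_add (g 0)).add
    (h2.const_mul (pd g (0, 1) 0))).add
    (((((h1.pow 2).const_mul (pd (pd g (1, 0)) (1, 0) 0)).add
      ((h1.mul h2).const_mul (2 * pd (pd g (1, 0)) (0, 1) 0))).add
      ((h2.pow 2).const_mul (pd (pd g (0, 1)) (0, 1) 0))).const_mul (1 / 2))).add
    (((((h1.pow 3).const_mul (pd (pd (pd g (1, 0)) (1, 0)) (1, 0) 0 / 6)).add
      (((h1.pow 2).mul h2).const_mul (pd (pd (pd g (1, 0)) (1, 0)) (0, 1) 0 / 2))).add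
      ((h1.mul (h2.pow 2)).const_mul (pd (pd (pd g (1, 0)) (0, 1)) (0, 1) 0 / 2))).add
      ((h2.pow 3).const_mul (pd (pd (pd g (0, 1)) (0, 1)) (0, 1) 0 / 6)))) ?_
  rw [pd_comm hg (0, 1) (1, 0), pd_comm (hg.pd (1, 0)) (0, 1) (1, 0)]
  ext <;> simp <;> ring

lemma isBigO_pow_mul_of_continuous {l : Filter ℝ} (hl : l ≤ 𝓝 0) (m : ℕ) {φ : ℝ → ℝ}
    (hφ : Continuous φ) : (fun h => h ^ m * φ h) =O[l] fun h => h ^ m := by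
  simpa using (isBigO_refl (fun h : ℝ => h ^ m) l).mul
    (((hφ.tendsto 0).mono_left hl).isBigO_one ℝ)

lemma isBigO_pow_of_le {l : Filter ℝ} (hl : l ≤ 𝓝 0) {i j : ℕ} (hij : i ≤ j) :
    (fun h : ℝ => h ^ j) =O[l] fun h => h ^ i := by
  obtain ⟨k, rfl⟩ := Nat.exists_eq_add_of_le hij
  simpa only [pow_add] using isBigO_pow_mul_of_continuous hl i (continuous_pow k)

/-- Expansion up to order `m ≤ 4` of `f` along the curve `h ↦ (t + α h, v + y h)`, given an
expansion of `y` and the Taylor expansion of `f` at `(t, v)`. -/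
lemma isBigO_comp_curve {f : ℝ × ℝ → ℝ} {t v F ft fu ftt ftu fuu c₀ c₁ c₂ c₃ : ℝ}
    (hT : (fun w : ℝ × ℝ => f ((t, v) + w) - (F + ft * w.1 + fu * w.2 +
      (1 / 2) * (ftt * w.1 ^ 2 + 2 * ftu * (w.1 * w.2) + fuu * w.2 ^ 2) +
      (c₀ * w.1 ^ 3 + c₁ * (w.1 ^ 2 * w.2) + c₂ * (w.1 * w.2 ^ 2) + c₃ * w.2 ^ 3)))
      =O[𝓝 0] fun w => ‖w‖ ^ 4)
    {l : Filter ℝ} (hl : l ≤ 𝓝 0) {m : ℕ} (hm1 : 1 ≤ m) (hm4 : m ≤ 4)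
    (α : ℝ) {y₁ y₂ y₃ : ℝ} {y : ℝ → ℝ}
    (hy : (fun h => y h - (y₁ * h + y₂ * h ^ 2 + y₃ * h ^ 3)) =O[l] fun h => h ^ m) :
    (fun h => f (t + α * h, v + y h) - (F + (ft * α + fu * y₁) * h +
      (fu * y₂ + (1 / 2) * (ftt * α ^ 2 + 2 * ftu * (α * y₁) + fuu * y₁ ^ 2)) * h ^ 2 +
      (fu * y₃ + ftu * (α * y₂) + fuu * (y₁ * y₂) +
        (c₀ * α ^ 3 + c₁ * (α ^ 2 * y₁) + c₂ * (α * y₁ ^ 2) + c₃ * y₁ ^ 3)) * h ^ 3))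
      =O[l] fun h => h ^ m := by
  have hid : Tendsto (fun h : ℝ => h) l (𝓝 0) := hl
  have hpow : ∀ {i j : ℕ}, i ≤ j → (fun h : ℝ => h ^ j) =O[l] fun h => h ^ i := fun hij =>
    isBigO_pow_of_le hl hij
  have hr0 : Tendsto (fun h => y h - (y₁ * h + y₂ * h ^ 2 + y₃ * h ^ 3)) l (𝓝 0) := by
    refine (hy.trans (hpow hm1)).trans_tendsto ?_
    simpa using hid
  have hhr := hid.prodMk_nhds hr0
  have hyO : y =O[l] fun h => h := by
    have h1 := isBigO_pow_mul_of_continuous hl 1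
      (show Continuous fun h => y₁ + y₂ * h + y₃ * h ^ 2 by fun_prop)
    refine (((hy.trans (hpow hm1)).add h1).congr_right fun h => pow_one h).congr_left fun h => ?_
    ring
  have hw : (fun h => (α * h, y h)) =O[l] fun h : ℝ => h :=
    ((isBigO_refl _ _).const_mul_left α).prod_left hyO
  have hw0 : Tendsto (fun h => (α * h, y h)) l (𝓝 0) := hw.trans_tendsto hid
  have hrem := (hT.comp_tendsto hw0).trans ((hw.norm_left.pow 4).trans (hpow hm4))
  have hφ : Continuous fun q : ℝ × ℝ => fu + ftu * α * q.1 +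
      (1 / 2) * fuu * (2 * (y₁ * q.1 + y₂ * q.1 ^ 2 + y₃ * q.1 ^ 3) + q.2) +
      c₁ * α ^ 2 * q.1 ^ 2 +
      c₂ * α * q.1 * (2 * (y₁ * q.1 + y₂ * q.1 ^ 2 + y₃ * q.1 ^ 3) + q.2) +
      c₃ * (3 * (y₁ * q.1 + y₂ * q.1 ^ 2 + y₃ * q.1 ^ 3) ^ 2 +
        3 * (y₁ * q.1 + y₂ * q.1 ^ 2 + y₃ * q.1 ^ 3) * q.2 + q.2 ^ 2) := by fun_prop
  have hψ : Continuous fun h : ℝ => ftu * α * y₃ +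
      (1 / 2) * fuu * (2 * y₁ * y₃ + (y₂ + y₃ * h) ^ 2) +
      (y₂ + y₃ * h) * (c₁ * α ^ 2 + c₂ * α * (2 * y₁ + h * (y₂ + y₃ * h)) +
        c₃ * ((y₁ + h * (y₂ + y₃ * h)) ^ 2 + (y₁ + h * (y₂ + y₃ * h)) * y₁ + y₁ ^ 2)) := by
    fun_prop
  have hA := hy.mul (((hφ.tendsto _).comp hhr).isBigO_one ℝ)
  have hB := (isBigO_pow_mul_of_continuous hl 4 hψ).trans (hpow hm4)
  simp only [mul_one] at hA
  refine ((hrem.add hA).add hB).congr_left fun h => ?_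
  simp only [Function.comp, Prod.mk_add_mk]
  ring

lemma abs_sqrt_one_add_sub_le (s : ℝ) : |√(1 + s) - (1 + s / 2)| ≤ s ^ 2 / 2 := by
  rcases le_or_gt 0 (1 + s) with hs | hs
  · obtain ⟨q, hq⟩ : ∃ q, q = √(1 + s) := ⟨_, rfl⟩
    have hq0 : 0 ≤ q := hq ▸ Real.sqrt_nonneg _
    obtain rfl : s = q ^ 2 - 1 := by rw [hq, Real.sq_sqrt hs]; ring
    rw [← hq, abs_le]
    constructor <;> nlinarith [mul_nonneg (sq_nonneg (q - 1)) hq0, sq_nonneg (q - 1),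
      mul_nonneg (mul_nonneg (sq_nonneg (q - 1)) hq0) hq0]
  · rw [Real.sqrt_eq_zero_of_nonpos hs.le, abs_le]
    constructor <;> nlinarith

lemma isBigO_sqrt_one_add (l : Filter ℝ) (z : ℝ) :
    (fun h => √(1 + z * h ^ 2) - (1 + z * h ^ 2 / 2)) =O[l] fun h => h ^ 4 := by
  refine IsBigO.of_bound (z ^ 2 / 2) (Eventually.of_forall fun h => ?_)
  refine (abs_sqrt_one_add_sub_le (z * h ^ 2)).trans (le_of_eq ?_)
  rw [Real.norm_eq_abs, abs_of_nonneg (by positivity)]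
  ring

lemma isBigO_integrate {U U' : ℝ → ℝ} {T d₀ d₁ d₂ d₃ : ℝ} {m : ℕ} (hT : 0 ≤ T)
    (hU : ∀ h ∈ Set.Icc 0 T, HasDerivWithinAt U (U' h) (Set.Icc 0 T) h)
    (hU' : (fun h => U' h - (d₀ + d₁ * h + d₂ * h ^ 2 + d₃ * h ^ 3))
      =O[𝓝[Set.Icc 0 T] 0] fun h => h ^ m) :
    (fun h => U h - U 0 - (d₀ * h + d₁ / 2 * h ^ 2 + d₂ / 3 * h ^ 3 + d₃ / 4 * h ^ 4))
      =O[𝓝[Set.Icc 0 T] 0] fun h => h ^ (m + 1) := by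
  have hG : ∀ h ∈ Set.Icc 0 T, HasDerivWithinAt
      (fun h => U h - (d₀ * h + d₁ / 2 * h ^ 2 + d₂ / 3 * h ^ 3 + d₃ / 4 * h ^ 4))
      (U' h - (d₀ + d₁ * h + d₂ * h ^ 2 + d₃ * h ^ 3)) (Set.Icc 0 T) h := fun h hh => by
    have hp : HasDerivAt
        (fun h : ℝ => d₀ * h + d₁ / 2 * h ^ 2 + d₂ / 3 * h ^ 3 + d₃ / 4 * h ^ 4)
        (d₀ + d₁ * h + d₂ * h ^ 2 + d₃ * h ^ 3) h := by
      refine ((((hasDerivAt_id h).const_mul d₀).add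
        ((hasDerivAt_pow 2 h).const_mul (d₁ / 2))).add
        ((hasDerivAt_pow 3 h).const_mul (d₂ / 3))).add
        ((hasDerivAt_pow 4 h).const_mul (d₃ / 4)) |>.congr_deriv ?_
      norm_num
      ring
    exact (hU h hh).sub hp.hasDerivWithinAt
  have key := isBigO_norm_pow_succ_of_hasFDerivWithinAt (n := m) (convex_Icc 0 T)
    (Set.left_mem_Icc.2 hT) (fun h hh => (hG h hh).hasFDerivWithinAt) (by
      refine IsBigO.of_norm_norm ?_
      simpa using hU'.norm_norm)
  refine IsBigO.of_norm_right ((key.congr_left fun h => ?_).congr_right fun h => ?_)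
  · ring
  · rw [norm_pow]

/-- Bootstrapping an expansion of `U` from expansions of its derivative. -/
lemma isBigO_bootstrap {U U' : ℝ → ℝ} {T y₁ y₂ y₃ d₃ : ℝ} (hT : 0 ≤ T)
    (hU : ∀ h ∈ Set.Icc 0 T, HasDerivWithinAt U (U' h) (Set.Icc 0 T) h)
    (hstep : ∀ m, 1 ≤ m → m ≤ 4 →
      (fun h => U h - U 0 - (y₁ * h + y₂ * h ^ 2 + y₃ * h ^ 3))
        =O[𝓝[Set.Icc 0 T] 0] (fun h => h ^ m) →
      (fun h => U' h - (y₁ + 2 * y₂ * h + 3 * y₃ * h ^ 2 + d₃ * h ^ 3))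
        =O[𝓝[Set.Icc 0 T] 0] fun h => h ^ m) :
    (fun h => U h - U 0 - (y₁ * h + y₂ * h ^ 2 + y₃ * h ^ 3 + d₃ / 4 * h ^ 4))
      =O[𝓝[Set.Icc 0 T] 0] fun h => h ^ 5 := by
  have hl : 𝓝[Set.Icc 0 T] (0 : ℝ) ≤ 𝓝 0 := nhdsWithin_le_nhds
  have hint : ∀ m, 1 ≤ m → m ≤ 4 →
      (fun h => U h - U 0 - (y₁ * h + y₂ * h ^ 2 + y₃ * h ^ 3))
        =O[𝓝[Set.Icc 0 T] 0] (fun h => h ^ m) →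
      (fun h => U h - U 0 - (y₁ * h + y₂ * h ^ 2 + y₃ * h ^ 3 + d₃ / 4 * h ^ 4))
        =O[𝓝[Set.Icc 0 T] 0] fun h => h ^ (m + 1) := fun m hm1 hm4 hm =>
    (isBigO_integrate hT hU (hstep m hm1 hm4 hm)).congr_left fun h => by ring
  have hall : ∀ m, 1 ≤ m → m ≤ 4 →
      (fun h => U h - U 0 - (y₁ * h + y₂ * h ^ 2 + y₃ * h ^ 3))
        =O[𝓝[Set.Icc 0 T] 0] (fun h => h ^ m) := by
    intro m hm1
    induction m, hm1 using Nat.le_induction with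
    | base =>
      intro _
      have h1 := (hU 0 (Set.left_mem_Icc.2 hT)).hasFDerivWithinAt.isBigO_sub
      have h2 := isBigO_pow_mul_of_continuous hl 1
        (show Continuous fun h => y₁ + y₂ * h + y₃ * h ^ 2 by fun_prop)
      refine ((h1.congr_right fun h => ?_).sub h2).congr_left fun h => ?_ <;> ring
    | succ m hm1 ih =>
      intro hm4
      have h1 := hint m hm1 (by omega) (ih (by omega))
      have h2 := ((isBigO_refl (fun h : ℝ => h ^ 4) _).const_mul_left (d₃ / 4)).trans
        (isBigO_pow_of_le hl hm4)
      exact (h1.add h2).congr_left fun h => by ring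
  exact hint 4 (by norm_num) le_rfl (hall 4 (by norm_num) le_rfl)

lemma isBigO_truncation_error {f : ℝ × ℝ → ℝ} {U : ℝ → ℝ}
    {t v F ft fu ftt ftu fuu c₀ c₁ c₂ c₃ e T : ℝ}
    (hf : (fun w : ℝ × ℝ => f ((t, v) + w) - (F + ft * w.1 + fu * w.2 +
      (1 / 2) * (ftt * w.1 ^ 2 + 2 * ftu * (w.1 * w.2) + fuu * w.2 ^ 2) +
      (c₀ * w.1 ^ 3 + c₁ * (w.1 ^ 2 * w.2) + c₂ * (w.1 * w.2 ^ 2) + c₃ * w.2 ^ 3)))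
      =O[𝓝 0] fun w => ‖w‖ ^ 4)
    (hT : 0 < T) (hU0 : U 0 = v)
    (hU : ∀ h ∈ Set.Icc 0 T, HasDerivWithinAt U (f (t + h, U h)) (Set.Icc 0 T) h)
    (he : e * (v * F * fuu + 2 * v * fu ^ 2 + v * ftu + F * fu) =
      F * ft * fuu + F * fu ^ 3 - F * fu * ftu + ft * fu ^ 2 + ft * ftu - ftt * fu)
    {k₂ k₃ : ℝ → ℝ}
    (hk₂ : ∀ h, k₂ h = f (t + 1 * h, (v + h * 1 * F) * √(1 + e * 1 ^ 2 * h ^ 2)))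
    (hk₃ : ∀ h, k₃ h = f (t + (1 / 2) * h,
      (v + h * ((1 / 4) * F + (1 / 4) * k₂ h)) * √(1 + -e * (1 / 2) ^ 2 * h ^ 2))) :
    (fun h => (U h - v) / h - ((1 / 6) * F + (1 / 6) * k₂ h + (2 / 3) * k₃ h))
      =O[𝓝[>] 0] fun h => h ^ 4 := by
  have hl : 𝓝[>] (0 : ℝ) ≤ 𝓝 0 := nhdsWithin_le_nhds
  have hIcc : 𝓝[>] (0 : ℝ) ≤ 𝓝[Set.Icc 0 T] 0 :=
    nhdsWithin_le_of_mem (mem_of_superset (Ioc_mem_nhdsGT hT) Set.Ioc_subset_Icc_self)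
  obtain ⟨A₁, hA₁⟩ : ∃ A₁, A₁ = ft * 1 + fu * F := ⟨_, rfl⟩
  obtain ⟨A₂, hA₂⟩ : ∃ A₂, A₂ = fu * (A₁ / 2) +
    (1 / 2) * (ftt * 1 ^ 2 + 2 * ftu * (1 * F) + fuu * F ^ 2) := ⟨_, rfl⟩
  obtain ⟨A₃, hA₃⟩ : ∃ A₃, A₃ = fu * (A₂ / 3) + ftu * (1 * (A₁ / 2)) + fuu * (F * (A₁ / 2)) +
    (c₀ * 1 ^ 3 + c₁ * (1 ^ 2 * F) + c₂ * (1 * F ^ 2) + c₃ * F ^ 3) := ⟨_, rfl⟩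
  have hUexp := (isBigO_bootstrap (y₁ := F) (y₂ := A₁ / 2) (y₃ := A₂ / 3) (d₃ := A₃) hT.le hU
    fun m hm1 hm4 hm => by
      refine (isBigO_comp_curve hf nhdsWithin_le_nhds hm1 hm4 1 hm).congr_left fun h => ?_
      rw [← hA₁, ← hA₂, ← hA₃, hU0, one_mul, add_sub_cancel]
      ring).mono hIcc
  rw [hU0] at hUexp
  have hdiv : (fun h => (U h - v) / h - (F + A₁ / 2 * h + A₂ / 3 * h ^ 2 + A₃ / 4 * h ^ 3))
      =O[𝓝[>] 0] fun h => h ^ 4 := by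
    refine (hUexp.mul (isBigO_refl (fun h : ℝ => h⁻¹) _)).congr' ?_ ?_ <;>
    · filter_upwards [self_mem_nhdsWithin] with h hh
      have : h ≠ 0 := (Set.mem_Ioi.1 hh).ne'
      field_simp
  have hs₂ := isBigO_sqrt_one_add (𝓝[>] 0) (e * 1 ^ 2)
  have hs₃ := isBigO_sqrt_one_add (𝓝[>] 0) (-e * (1 / 2) ^ 2)
  have hy₂ : (fun h => ((v + h * 1 * F) * √(1 + e * 1 ^ 2 * h ^ 2) - v) -
      (F * h + e * v / 2 * h ^ 2 + e * F / 2 * h ^ 3)) =O[𝓝[>] 0] fun h => h ^ 4 := by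
    have hb := (((show Continuous fun h : ℝ => v + h * 1 * F by fun_prop).tendsto 0).mono_left
      hl).isBigO_one ℝ
    refine ((hb.mul hs₂).congr_left fun h => ?_).congr_right fun h => one_mul _
    ring
  have hK₂ := isBigO_comp_curve hf hl (by norm_num) le_rfl 1 hy₂
  simp only [add_sub_cancel, ← hk₂, ← hA₁] at hK₂
  generalize hB₂ : fu * (e * v / 2) +
    (1 / 2) * (ftt * 1 ^ 2 + 2 * ftu * (1 * F) + fuu * F ^ 2) = B₂ at hK₂
  generalize hB₃ : fu * (e * F / 2) + ftu * (1 * (e * v / 2)) + fuu * (F * (e * v / 2)) +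
    (c₀ * 1 ^ 3 + c₁ * (1 ^ 2 * F) + c₂ * (1 * F ^ 2) + c₃ * F ^ 3) = B₃ at hK₂
  have hk₂0 : k₂ =O[𝓝[>] 0] fun _ => (1 : ℝ) := by
    have h1 := ((show Continuous fun h : ℝ => F + A₁ * h + B₂ * h ^ 2 + B₃ * h ^ 3 by
      fun_prop).tendsto 0).mono_left hl |>.isBigO_one ℝ
    have h2 := hK₂.trans (isBigO_pow_of_le hl (Nat.zero_le 4))
    simp only [pow_zero] at h2
    exact (h2.add h1).congr_left fun h => by ring
  have hy₃ : (fun h => ((v + h * ((1 / 4) * F + (1 / 4) * k₂ h)) *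
      √(1 + -e * (1 / 2) ^ 2 * h ^ 2) - v) -
      (F / 2 * h + (A₁ / 4 - e * v / 8) * h ^ 2 + (B₂ / 4 - e * F / 16) * h ^ 3))
      =O[𝓝[>] 0] fun h => h ^ 4 := by
    have hid : (fun h : ℝ => h) =O[𝓝[>] 0] fun _ => (1 : ℝ) := Tendsto.isBigO_one ℝ hl
    have hb : (fun h => v + h * ((1 / 4) * F + (1 / 4) * k₂ h)) =O[𝓝[>] 0] fun _ => (1 : ℝ) := by
      have hc : ∀ c : ℝ, (fun _ : ℝ => c) =O[𝓝[>] 0] fun _ => (1 : ℝ) := fun c =>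
        isBigO_const_const c one_ne_zero _
      exact (hc v).add ((hid.mul ((hc _).add (hk₂0.const_mul_left _))).congr_right
        fun h => one_mul 1)
    have hq := (((show Continuous fun h : ℝ => h / 4 * (1 - e * h ^ 2 / 8) by
      fun_prop).tendsto 0).mono_left hl).isBigO_one ℝ
    have hr := isBigO_pow_mul_of_continuous hl 4 (show Continuous fun h : ℝ =>
      B₃ / 4 - e / 32 * (A₁ + B₂ * h + B₃ * h ^ 2) by fun_prop)
    refine ((((hb.mul hs₃).add (hq.mul hK₂)).congr_right fun h => one_mul _).add hr).congr_left
      fun h => ?_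
    ring
  have hK₃ := isBigO_comp_curve hf hl (by norm_num) le_rfl (1 / 2) hy₃
  simp only [add_sub_cancel, ← hk₃] at hK₃
  refine ((hdiv.sub (hK₂.const_mul_left (1 / 6))).sub (hK₃.const_mul_left (2 / 3))).congr_left
    fun h => ?_
  subst hB₂ hB₃ hA₃ hA₂ hA₁
  linear_combination (h ^ 3 / 24) * he

/-- Fourth-order accuracy of the three-stage MQ-RBF Runge–Kutta method (case II):
`a₂₁ = c₂ = 1`, `a₃₁ = 1/4`, `a₃₂ = 1/4`, `c₃ = 1/2`, `b₁ = 1/6`, `b₂ = 1/6`,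
`b₃ = 2/3`, shape parameters
`ε₂² = (f f_t f_uu + f f_u³ − f f_u f_tu + f_t f_u² + f_t f_tu − f_tt f_u)
      /(v f f_uu + 2v f_u² + v f_tu + f f_u)` and `ε₃² = −ε₂²` (denominator nonzero);
then the local truncation error is `O(h⁴)` as `h → 0⁺`. -/
theorem mq_rk3_fourth_order_II
    (a b : ℝ) (hab : a < b) (f : ℝ × ℝ → ℝ) (hf : ContDiff ℝ (⊤ : ℕ∞) f)
    (u : ℝ → ℝ) (hu : ContDiffOn ℝ (⊤ : ℕ∞) u (Set.Icc a b))
    (hode : ∀ s ∈ Set.Icc a b, HasDerivWithinAt u (f (s, u s)) (Set.Icc a b) s)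
    (t : ℝ) (ht : t ∈ Set.Ico a b) :
    let v := u t
    let F := f (t, v)
    let ft := pd f (1, 0) (t, v)
    let fu := pd f (0, 1) (t, v)
    let ftt := pd (pd f (1, 0)) (1, 0) (t, v)
    let ftu := pd (pd f (1, 0)) (0, 1) (t, v)
    let fuu := pd (pd f (0, 1)) (0, 1) (t, v)
    let den := v * F * fuu + 2 * v * fu ^ 2 + v * ftu + F * fu
    let eps2 := (F * ft * fuu + F * fu ^ 3 - F * fu * ftu + ft * fu ^ 2 +
      ft * ftu - ftt * fu) / den
    let eps3 := -eps2
    den ≠ 0 →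
    ∃ C > 0, ∃ h₀ > 0, ∀ h : ℝ, 0 < h → h ≤ h₀ →
      let k1 := F
      let k2 := f (t + 1 * h,
        (v + h * 1 * k1) * Real.sqrt (1 + eps2 * 1 ^ 2 * h ^ 2))
      let k3 := f (t + (1 / 2) * h,
        (v + h * ((1 / 4) * k1 + (1 / 4) * k2)) *
          Real.sqrt (1 + eps3 * (1 / 2) ^ 2 * h ^ 2))
      |(u (t + h) - u t) / h - ((1 / 6) * k1 + (1 / 6) * k2 + (2 / 3) * k3)| ≤
        C * h ^ 4 := by
  intro v F ft fu ftt ftu fuu den eps2 eps3 hden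
  have hshift : ContDiff ℝ (⊤ : ℕ∞) fun w => f ((t, v) + w) :=
    hf.comp (contDiff_const.add contDiff_id)
  obtain ⟨c₀, c₁, c₂, c₃, hT⟩ := exists_isBigO_taylor_three hshift
  simp only [pd_comp_add_left, add_zero] at hT
  have hU : ∀ h ∈ Set.Icc 0 (b - t), HasDerivWithinAt (fun h => u (t + h)) (f (t + h, u (t + h)))
      (Set.Icc 0 (b - t)) h := fun h hh => by
    have hmem : ∀ s ∈ Set.Icc 0 (b - t), t + s ∈ Set.Icc a b := fun s hs =>
      ⟨by linarith [hs.1, ht.1], by linarith [hs.2]⟩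
    exact ((hode (t + h) (hmem h hh)).comp h ((hasDerivWithinAt_id h _).const_add t)
      hmem).congr_deriv (mul_one _)
  have key := isBigO_truncation_error hT (sub_pos.2 ht.2) (by simp [v]) hU
    (div_mul_cancel₀ _ hden) (fun _ => rfl) (fun _ => rfl)
  obtain ⟨C, hC, hb⟩ := key.exists_pos
  obtain ⟨h₀, hh₀, hsub⟩ := mem_nhdsGT_iff_exists_Ioc_subset.1 hb.bound
  refine ⟨C, hC, h₀, hh₀, fun h hpos hle => ?_⟩
  exact (hsub ⟨hpos, hle⟩).trans_eq (by rw [Real.norm_eq_abs, abs_of_pos (pow_pos hpos 4)])
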